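/- arXiv:1910.09679 — 4 statements merged into one kernel-verified Lean document; each statement's English description precedes it below -/
import Mathlib

section
/- Let σ ∈ (0,1), τ > 0, a > 0, b > 0, ρ₀(w) = Γ(1−σ)⁻¹ w^(−1−σ) e^(−τw) and f_{a,b}(β) = (b^a/Γ(a)) β^(a−1) e^(−bβ). Then the iterated integral ∫₀^∞ ∫₀^∞ [ (1 − e^(−w)) · min(1, w + wβ) + e^(−w) · min(1, wβ) ] f_{a,b}(β) ρ₀(w) dβ dw is finite. (This is the integrability condition ∫_{ℝ₊²} min(1, w₁ + w₂) ρ(dw₁, dw₂) < ∞ for the paper's core-periphery Lévy measure ρ of Equation (11), written out as an iterated integral over the base weight w and the score β.) -/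
open MeasureTheory Real Set

/-- The generalized gamma process (GGP) Lévy density
`ρ₀(w) = Γ(1−σ)⁻¹ w^(−1−σ) e^(−τw)`. -/
noncomputable def ggpDensity (σ τ w : ℝ) : ℝ :=
  (Real.Gamma (1 - σ))⁻¹ * w ^ (-1 - σ) * Real.exp (-τ * w)

/-- The Gamma(a,b) probability density `f_{a,b}(β) = (b^a/Γ(a)) β^(a−1) e^(−bβ)`. -/
noncomputable def gammaDensity (a b β : ℝ) : ℝ :=
  b ^ a / Real.Gamma a * β ^ (a - 1) * Real.exp (-b * β)

theorem integrableOn_rpow_mul_exp_neg_mul {s c : ℝ} (hs : -1 < s) (hc : 0 < c) :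
    IntegrableOn (fun x : ℝ => x ^ s * Real.exp (-c * x)) (Set.Ioi 0) := by
  simpa using integrableOn_rpow_mul_exp_neg_mul_rpow hs one_pos hc

theorem integrableOn_mul_ggpDensity {σ τ : ℝ} (hσ : σ < 1) (hτ : 0 < τ) :
    IntegrableOn (fun w => w * ggpDensity σ τ w) (Set.Ioi 0) := by
  refine IntegrableOn.congr_fun
    ((integrableOn_rpow_mul_exp_neg_mul (s := -σ) (by linarith) hτ).const_mul
      (Real.Gamma (1 - σ))⁻¹) (fun w hw => ?_) measurableSet_Ioi
  have h : w ^ (-σ) = w ^ (-1 - σ) * w := by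
    rw [← Real.rpow_add_one (ne_of_gt hw)]
    ring_nf
  simp only [ggpDensity, h]
  ring

theorem integrableOn_one_add_mul_gammaDensity {a b : ℝ} (ha : 0 < a) (hb : 0 < b) :
    IntegrableOn (fun β => (1 + β) * gammaDensity a b β) (Set.Ioi 0) := by
  refine IntegrableOn.congr_fun
    (((integrableOn_rpow_mul_exp_neg_mul (s := a - 1) (by linarith) hb).add
      (integrableOn_rpow_mul_exp_neg_mul (s := a) (by linarith) hb)).const_mul
      (b ^ a / Real.Gamma a)) (fun β hβ => ?_) measurableSet_Ioi
  have h : β ^ a = β ^ (a - 1) * β := by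
    rw [← Real.rpow_add_one (ne_of_gt hβ)]
    ring_nf
  simp only [gammaDensity, Pi.add_apply, h]
  ring

theorem ggpDensity_nonneg {σ w : ℝ} (τ : ℝ) (hσ : σ < 1) (hw : 0 ≤ w) :
    0 ≤ ggpDensity σ τ w := by
  have := Real.Gamma_pos_of_pos (sub_pos.2 hσ)
  unfold ggpDensity
  positivity

theorem gammaDensity_nonneg {a b β : ℝ} (ha : 0 < a) (hb : 0 ≤ b) (hβ : 0 ≤ β) :
    0 ≤ gammaDensity a b β := by
  have := Real.Gamma_pos_of_pos ha
  unfold gammaDensity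
  positivity

/-- The truncated mass of a core-periphery atom is at most linear in its base weight. -/
theorem core_periphery_truncation_le {w β : ℝ} (hw : 0 ≤ w) :
    (1 - Real.exp (-w)) * min 1 (w + w * β) + Real.exp (-w) * min 1 (w * β)
      ≤ w * (1 + β) := by
  have hexp : Real.exp (-w) ≤ 1 := Real.exp_le_one_iff.2 (by linarith)
  have hcore : (1 - Real.exp (-w)) * min 1 (w + w * β)
      ≤ (1 - Real.exp (-w)) * (w * (1 + β)) :=
    mul_le_mul_of_nonneg_left ((min_le_right _ _).trans (by linarith)) (by linarith)
  have hperiphery : Real.exp (-w) * min 1 (w * β) ≤ Real.exp (-w) * (w * (1 + β)) :=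
    mul_le_mul_of_nonneg_left ((min_le_right _ _).trans (by linarith)) (Real.exp_pos _).le
  linarith

/-- The integrability condition `∫ min(1, w₁ + w₂) ρ(dw₁,dw₂) < ∞` for the
core-periphery Lévy measure, written as an iterated integral over the base
weight `w` and the score `β`. -/
theorem coreperiphery_levy_integrability
    (σ τ a b : ℝ) (hσ : σ ∈ Set.Ioo (0:ℝ) 1) (hτ : 0 < τ) (ha : 0 < a) (hb : 0 < b) :
    (∫⁻ w in Set.Ioi (0:ℝ), ∫⁻ β in Set.Ioi (0:ℝ),
      ENNReal.ofReal
        (((1 - Real.exp (-w)) * min 1 (w + w * β)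
          + Real.exp (-w) * min 1 (w * β)) * gammaDensity a b β * ggpDensity σ τ w))
      < ⊤ := by
  calc
    _ ≤ ∫⁻ w in Set.Ioi (0:ℝ), ∫⁻ β in Set.Ioi (0:ℝ),
        ENNReal.ofReal (w * ggpDensity σ τ w) *
          ENNReal.ofReal ((1 + β) * gammaDensity a b β) := by
      refine setLIntegral_mono' measurableSet_Ioi fun w hw =>
        setLIntegral_mono' measurableSet_Ioi fun β hβ => ?_
      have hw' : 0 ≤ w := le_of_lt hw
      have hβ' : 0 ≤ β := le_of_lt hβ
      have hg := ggpDensity_nonneg τ hσ.2 hw'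
      have hf := gammaDensity_nonneg ha hb.le hβ'
      rw [← ENNReal.ofReal_mul (mul_nonneg hw' hg)]
      refine ENNReal.ofReal_le_ofReal ?_
      calc
        _ ≤ w * (1 + β) * gammaDensity a b β * ggpDensity σ τ w := by
          gcongr
          exact core_periphery_truncation_le hw'
        _ = _ := by ring
    _ = (∫⁻ w in Set.Ioi (0:ℝ), ENNReal.ofReal (w * ggpDensity σ τ w)) *
        ∫⁻ β in Set.Ioi (0:ℝ), ENNReal.ofReal ((1 + β) * gammaDensity a b β) := by
      have hfin := (integrableOn_one_add_mul_gammaDensity ha hb).lintegral_lt_top.ne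
      simp_rw [lintegral_const_mul' _ _ ENNReal.ofReal_ne_top]
      rw [lintegral_mul_const' _ _ hfin]
    _ < ⊤ := ENNReal.mul_lt_top
      (integrableOn_mul_ggpDensity hσ.2 hτ).lintegral_lt_top
      (integrableOn_one_add_mul_gammaDensity ha hb).lintegral_lt_top
end

section
/- Let σ ∈ (0,1), τ > 0, a > 0, b > 0, ρ₀(w) = Γ(1−σ)⁻¹ w^(−1−σ) e^(−τw) and f_{a,b}(β) = (b^a/Γ(a)) β^(a−1) e^(−bβ). Define the periphery sociability Lévy density ρ_p(x) = ∫₀^∞ e^(−w) w⁻¹ f_{a,b}(x/w) ρ₀(w) dw for x > 0. Then ρ_p(x) is asymptotically equivalent to C x^(−1−σ) as x → 0⁺, i.e. lim_{x→0⁺} x^(1+σ) ρ_p(x) = C, where C = Γ(a+σ) / (Γ(a) b^σ Γ(1−σ)). (The constant C equals E[β^σ]/Γ(1−σ) for β ~ Gamma(a,b).) -/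
open MeasureTheory Real Set Filter Topology

/-- The Lévy density of periphery sociabilities
`ρ_p(x) = ∫₀^∞ e^(−w) w⁻¹ f_{a,b}(x/w) ρ₀(w) dw`. -/
noncomputable def periphDensity (σ τ a b x : ℝ) : ℝ :=
  ∫ w in Set.Ioi (0:ℝ),
    Real.exp (-w) * w⁻¹ * gammaDensity a b (x / w) * ggpDensity σ τ w

/-- The substitution `w = x / β` on the positive half-line. -/
theorem integral_Ioi_comp_div (g : ℝ → ℝ) {x : ℝ} (hx : 0 < x) :
    ∫ w in Ioi (0:ℝ), g w = ∫ β in Ioi (0:ℝ), x * β ^ (-2 : ℝ) * g (x * β⁻¹) := by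
  have h1 := integral_comp_mul_left_Ioi g 0 hx
  rw [mul_zero, smul_eq_mul] at h1
  have h2 := integral_comp_rpow_Ioi (fun u => g (x * u)) (p := -1) (by norm_num)
  rw [h1] at h2
  have h3 : ∫ w in Ioi (0:ℝ), g w = x * (x⁻¹ * ∫ w in Ioi (0:ℝ), g w) := by
    field_simp
  rw [h3, ← h2, ← integral_const_mul]
  refine setIntegral_congr_fun measurableSet_Ioi fun β _ => ?_
  norm_num [rpow_neg_one, mul_assoc]

/-- The density of periphery sociabilities, rescaled, as a gamma integral with an
exponential tilting that disappears as `x → 0⁺`. -/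
theorem rpow_mul_periphDensity (σ τ a b : ℝ) {x : ℝ} (hx : 0 < x) :
    x ^ (1 + σ) * periphDensity σ τ a b x =
      (b ^ a / Real.Gamma a * (Real.Gamma (1 - σ))⁻¹) *
        ∫ β in Ioi (0:ℝ), Real.exp (-((1 + τ) * x * β⁻¹)) *
          (β ^ (a + σ - 1) * Real.exp (-(b * β))) := by
  rw [periphDensity, integral_Ioi_comp_div _ hx, ← integral_const_mul, ← integral_const_mul]
  refine setIntegral_congr_fun measurableSet_Ioi fun β hβ => ?_
  have hβ : 0 < β := hβ
  have e1 : x / (x * β⁻¹) = β := by field_simp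
  have e2 : (x * β⁻¹) ^ (-1 - σ) = (x ^ (1 + σ))⁻¹ * β ^ (1 + σ) := by
    rw [mul_rpow hx.le (inv_nonneg.2 hβ.le), inv_rpow hβ.le, ← rpow_neg hβ.le, ← rpow_neg hx.le]
    ring_nf
  have e3 : Real.exp (-((1 + τ) * x * β⁻¹)) =
      Real.exp (-(x * β⁻¹)) * Real.exp (-τ * (x * β⁻¹)) := by
    rw [← Real.exp_add]; ring_nf
  have e4 : β ^ (a + σ - 1) = β ^ (-2 : ℝ) * β * β ^ (a - 1) * β ^ (1 + σ) := by
    nth_rewrite 3 [← rpow_one β]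
    rw [← rpow_add hβ, ← rpow_add hβ, ← rpow_add hβ]
    ring_nf
  have hne : x ^ (1 + σ) ≠ 0 := (rpow_pos_of_pos hx _).ne'
  simp only [gammaDensity, ggpDensity]
  rw [e1, e2, e3, e4, neg_mul b β]
  field_simp

/-- `ρ_p(x) ∼ C x^(−1−σ)` as `x → 0⁺`, i.e. `x^(1+σ) ρ_p(x) → C`, with
`C = Γ(a+σ) / (Γ(a) b^σ Γ(1−σ))`. -/
theorem periphery_density_asymptotics
    (σ τ a b : ℝ) (hσ : σ ∈ Set.Ioo (0:ℝ) 1) (hτ : 0 < τ) (ha : 0 < a) (hb : 0 < b) :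
    Filter.Tendsto (fun x : ℝ => x ^ (1 + σ) * periphDensity σ τ a b x)
      (nhdsWithin 0 (Set.Ioi 0))
      (nhds (Real.Gamma (a + σ) / (Real.Gamma a * b ^ σ * Real.Gamma (1 - σ)))) := by
  have hs : 0 < a + σ := add_pos ha hσ.1
  have hC : Real.Gamma (a + σ) / (Real.Gamma a * b ^ σ * Real.Gamma (1 - σ)) =
      (b ^ a / Real.Gamma a * (Real.Gamma (1 - σ))⁻¹) *
        ∫ β in Ioi (0:ℝ), β ^ (a + σ - 1) * Real.exp (-(b * β)) := by
    rw [Real.integral_rpow_mul_exp_neg_mul_Ioi hs hb, one_div, inv_rpow hb.le, rpow_add hb]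
    have := (rpow_pos_of_pos hb a).ne'
    have := (rpow_pos_of_pos hb σ).ne'
    field_simp
  have hint : IntegrableOn (fun β : ℝ => β ^ (a + σ - 1) * Real.exp (-(b * β))) (Ioi 0) := by
    simpa [rpow_one] using
      integrableOn_rpow_mul_exp_neg_mul_rpow (p := 1) (s := a + σ - 1) (by linarith) one_pos hb
  rw [hC]
  refine Tendsto.congr' (eventually_nhdsWithin_of_forall fun x hx =>
    (rpow_mul_periphDensity σ τ a b hx).symm) (Tendsto.const_mul _ ?_)
  refine tendsto_integral_filter_of_dominated_convergence _ ?_ ?_ hint ?_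
  · exact Eventually.of_forall fun x => Measurable.aestronglyMeasurable (by fun_prop)
  · refine eventually_nhdsWithin_of_forall fun x hx => ?_
    filter_upwards [ae_restrict_mem measurableSet_Ioi] with β hβ
    have hβ : 0 < β := hβ
    have hx : 0 < x := hx
    rw [Real.norm_of_nonneg (by positivity)]
    refine mul_le_of_le_one_left (by positivity) (Real.exp_le_one_iff.2 ?_)
    have : 0 < (1 + τ) * x * β⁻¹ := by positivity
    linarith
  · refine Eventually.of_forall fun β => ?_
    have hc : Continuous fun x : ℝ => Real.exp (-((1 + τ) * x * β⁻¹)) *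
        (β ^ (a + σ - 1) * Real.exp (-(b * β))) := by fun_prop
    simpa using (hc.tendsto 0).mono_left nhdsWithin_le_nhds
end

section
/- Let σ ∈ (0,1), τ > 0, a > 0, b > 0, ρ₀(w) = Γ(1−σ)⁻¹ w^(−1−σ) e^(−τw) and f_{a,b}(β) = (b^a/Γ(a)) β^(a−1) e^(−bβ), and define ρ_p(x) = ∫₀^∞ e^(−w) w⁻¹ f_{a,b}(x/w) ρ₀(w) dw for x > 0. Then the tail integral satisfies lim_{x→0⁺} x^σ ∫_x^∞ ρ_p(t) dt = Γ(a+σ) / (σ Γ(a) b^σ Γ(1−σ)). In particular the periphery Lévy measure ρ_p(t) dt has infinite total mass, with regularly varying tail of index −σ at 0. -/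
open MeasureTheory Real Set Filter Topology

/-- The Gamma integral `∫₀^∞ β^(s−1) e^(−bβ) dβ` damped by the factor `e^(−c|x|/β)`. -/
noncomputable def dampedGammaIntegral (s b c x : ℝ) : ℝ :=
  ∫ β in Set.Ioi (0:ℝ), β ^ (s - 1) * Real.exp (-(b * β)) * Real.exp (-(c * |x| / β))

theorem integrableOn_rpow_mul_exp_neg_mul_Ioi {s b : ℝ} (hs : 0 < s) (hb : 0 < b) :
    IntegrableOn (fun β : ℝ => β ^ (s - 1) * Real.exp (-(b * β))) (Set.Ioi 0) := by
  have := integrableOn_rpow_mul_exp_neg_mul_rpow (p := 1) (s := s - 1) (b := b)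
    (by linarith) one_pos hb
  simpa using this

theorem norm_dampedGammaIntegrand_le {s b c β : ℝ} (hc : 0 ≤ c) (hβ : 0 < β) (x : ℝ) :
    ‖β ^ (s - 1) * Real.exp (-(b * β)) * Real.exp (-(c * |x| / β))‖
      ≤ β ^ (s - 1) * Real.exp (-(b * β)) := by
  rw [Real.norm_of_nonneg (by positivity)]
  refine mul_le_of_le_one_right (by positivity) (Real.exp_le_one_iff.2 ?_)
  have : 0 ≤ c * |x| / β := by positivity
  linarith

theorem continuous_dampedGammaIntegral {s b c : ℝ} (hs : 0 < s) (hb : 0 < b) (hc : 0 ≤ c) :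
    Continuous (dampedGammaIntegral s b c) := by
  refine MeasureTheory.continuous_of_dominated
    (bound := fun β => β ^ (s - 1) * Real.exp (-(b * β))) (fun x => ?_) (fun x => ?_)
    (integrableOn_rpow_mul_exp_neg_mul_Ioi hs hb) ?_
  · exact Measurable.aestronglyMeasurable (by fun_prop)
  · exact (ae_restrict_mem measurableSet_Ioi).mono
      fun β hβ => norm_dampedGammaIntegrand_le hc hβ x
  · exact Filter.Eventually.of_forall fun β => by fun_prop

theorem dampedGammaIntegral_nonneg (s b c x : ℝ) : 0 ≤ dampedGammaIntegral s b c x :=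
  setIntegral_nonneg measurableSet_Ioi fun β hβ => by
    have : 0 < β := hβ
    positivity

theorem dampedGammaIntegral_zero {s b : ℝ} (hs : 0 < s) (hb : 0 < b) (c : ℝ) :
    dampedGammaIntegral s b c 0 = Real.Gamma s / b ^ s := by
  simp only [dampedGammaIntegral, abs_zero, mul_zero, zero_div, neg_zero, Real.exp_zero, mul_one]
  rw [Real.integral_rpow_mul_exp_neg_mul_Ioi hs hb, Real.div_rpow zero_le_one hb.le,
    Real.one_rpow, one_div_mul_eq_div]

theorem norm_dampedGammaIntegral_le {s b c : ℝ} (hs : 0 < s) (hb : 0 < b) (hc : 0 ≤ c) (x : ℝ) :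
    ‖dampedGammaIntegral s b c x‖ ≤ Real.Gamma s / b ^ s := by
  rw [← dampedGammaIntegral_zero hs hb 0]
  refine norm_integral_le_of_norm_le ?_ ((ae_restrict_mem measurableSet_Ioi).mono fun β hβ => ?_)
  · simpa [IntegrableOn] using integrableOn_rpow_mul_exp_neg_mul_Ioi hs hb
  · simpa using norm_dampedGammaIntegrand_le hc hβ x

/-- Abelian tail asymptotics: a density `t^(−1−σ) H(t)` with `H` bounded and continuous has tail
integral asymptotic to `H(0) x^(−σ) / σ` at `0⁺`. -/
theorem tendsto_rpow_mul_integral_Ioi_rpow_mul {σ M : ℝ} (hσ : 0 < σ) {H : ℝ → ℝ}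
    (hH : Continuous H) (hM : ∀ x, ‖H x‖ ≤ M) :
    Filter.Tendsto (fun x : ℝ => x ^ σ * ∫ t in Set.Ioi x, t ^ (-1 - σ) * H t)
      (nhdsWithin 0 (Set.Ioi 0)) (nhds (H 0 / σ)) := by
  have hrescale : ∀ x ∈ Set.Ioi (0:ℝ), ∫ s in Set.Ioi (1:ℝ), s ^ (-1 - σ) * H (x * s)
      = x ^ σ * ∫ t in Set.Ioi x, t ^ (-1 - σ) * H t := by
    intro x hx
    have hx : 0 < x := hx
    have h := integral_comp_mul_left_Ioi' (fun t => t ^ (-1 - σ) * H t) 1 hx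
    rw [mul_one] at h
    rw [← h, smul_eq_mul, ← integral_const_mul, ← integral_const_mul]
    refine setIntegral_congr_fun measurableSet_Ioi fun s hs => ?_
    have hs : (0:ℝ) < s := one_pos.trans hs
    have hone : x ^ σ * x * x ^ (-1 - σ) = 1 := by
      rw [← Real.rpow_add_one hx.ne', ← Real.rpow_add hx,
        show σ + 1 + (-1 - σ) = 0 by ring, Real.rpow_zero]
    simp only [Real.mul_rpow hx.le hs.le]
    linear_combination (-(s ^ (-1 - σ) * H (x * s))) * hone
  refine Filter.Tendsto.congr' (eventually_nhdsWithin_of_forall hrescale) ?_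
  have hlim : H 0 / σ = ∫ s in Set.Ioi (1:ℝ), s ^ (-1 - σ) * H 0 := by
    rw [integral_mul_const, integral_Ioi_rpow_of_lt (by linarith) one_pos, Real.one_rpow,
      show -1 - σ + 1 = -σ by ring]
    field_simp
  rw [hlim]
  refine MeasureTheory.tendsto_integral_filter_of_dominated_convergence
    (fun s => s ^ (-1 - σ) * M) ?_ ?_ ?_ ?_
  · refine Filter.Eventually.of_forall fun x => Measurable.aestronglyMeasurable ?_
    have := hH.measurable
    fun_prop
  · refine Filter.Eventually.of_forall fun x => (ae_restrict_mem measurableSet_Ioi).mono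
      fun s hs => ?_
    have hs : (0:ℝ) < s := one_pos.trans hs
    rw [norm_mul, Real.norm_of_nonneg (Real.rpow_nonneg hs.le _)]
    exact mul_le_mul_of_nonneg_left (hM _) (Real.rpow_nonneg hs.le _)
  · exact (integrableOn_Ioi_rpow_of_lt (by linarith) one_pos).mul_const M
  · refine Filter.Eventually.of_forall fun s => ?_
    have hc : Continuous fun x : ℝ => s ^ (-1 - σ) * H (x * s) := by fun_prop
    simpa using (hc.tendsto 0).mono_left nhdsWithin_le_nhds

theorem lintegral_Ioi_eq_top_of_tendsto_rpow_mul_integral {f : ℝ → ℝ} {σ L : ℝ} (hσ : 0 < σ)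
    (hL : 0 < L) (hf : AEStronglyMeasurable f (volume.restrict (Set.Ioi 0)))
    (hf0 : ∀ t ∈ Set.Ioi (0:ℝ), 0 ≤ f t)
    (hlim : Filter.Tendsto (fun x : ℝ => x ^ σ * ∫ t in Set.Ioi x, f t)
      (nhdsWithin 0 (Set.Ioi 0)) (nhds L)) :
    ∫⁻ t in Set.Ioi (0:ℝ), ENNReal.ofReal (f t) = ⊤ := by
  by_contra hfin
  have hnn : 0 ≤ᵐ[volume.restrict (Set.Ioi 0)] f := (ae_restrict_mem measurableSet_Ioi).mono hf0
  have hint : IntegrableOn f (Set.Ioi 0) :=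
    ⟨hf, (hasFiniteIntegral_iff_ofReal hnn).2 (lt_top_iff_ne_top.2 hfin)⟩
  have hzero : Filter.Tendsto (fun x : ℝ => x ^ σ * ∫ t in Set.Ioi (0:ℝ), f t)
      (nhdsWithin 0 (Set.Ioi 0)) (nhds 0) := by
    have hc : Continuous fun x : ℝ => x ^ σ * ∫ t in Set.Ioi (0:ℝ), f t :=
      (Real.continuous_rpow_const hσ.le).mul continuous_const
    simpa [Real.zero_rpow hσ.ne'] using (hc.tendsto 0).mono_left nhdsWithin_le_nhds
  refine hL.not_ge (le_of_tendsto_of_tendsto hlim hzero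
    (eventually_nhdsWithin_of_forall fun x hx => ?_))
  have hx : (0:ℝ) < x := hx
  exact mul_le_mul_of_nonneg_left
    (setIntegral_mono_set hint hnn (Set.Ioi_subset_Ioi hx.le).eventuallyLE)
    (Real.rpow_nonneg hx.le _)

theorem periphDensity_eq (σ τ a b : ℝ) {x : ℝ} (hx : 0 < x) :
    periphDensity σ τ a b x = x ^ (-1 - σ) *
      (b ^ a / Real.Gamma a * (Real.Gamma (1 - σ))⁻¹ *
        dampedGammaIntegral (a + σ) b (1 + τ) x) := by
  have h := integral_comp_mul_left_Ioi' (fun w => Real.exp (-w) * w⁻¹ *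
    gammaDensity a b (x / w) * ggpDensity σ τ w) 0 hx
  rw [mul_zero, ← integral_comp_rpow_Ioi _ (show (-1:ℝ) ≠ 0 by norm_num)] at h
  rw [periphDensity, ← h, dampedGammaIntegral, smul_eq_mul, ← integral_const_mul,
    ← integral_const_mul, ← integral_const_mul]
  refine setIntegral_congr_fun measurableSet_Ioi fun β hβ => ?_
  have hβ : 0 < β := hβ
  have hquot : x / (x * β ^ (-1:ℝ)) = β := by
    rw [Real.rpow_neg_one]
    field_simp
  have hexp : Real.exp (-(x * β⁻¹)) * Real.exp (-τ * (x * β⁻¹))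
      = Real.exp (-((1 + τ) * |x| / β)) := by
    rw [← Real.exp_add, abs_of_pos hx]
    congr 1
    ring
  have hpow : β ^ (-1 - 1 : ℝ) * β * β ^ (a - 1) * β⁻¹ ^ (-1 - σ) = β ^ (a + σ - 1) := by
    rw [Real.inv_rpow hβ.le, ← Real.rpow_neg hβ.le, ← Real.rpow_add_one hβ.ne',
      ← Real.rpow_add hβ, ← Real.rpow_add hβ]
    congr 1
    ring
  simp only [smul_eq_mul, gammaDensity, ggpDensity, hquot]
  simp only [Real.rpow_neg_one, abs_neg, abs_one, one_mul]
  rw [Real.mul_rpow hx.le (inv_nonneg.2 hβ.le), ← hexp, ← hpow, mul_inv, inv_inv, neg_mul b β]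
  field_simp

/-- The tail integral of the periphery Lévy density satisfies
`x^σ ∫_x^∞ ρ_p(t) dt → Γ(a+σ)/(σ Γ(a) b^σ Γ(1−σ))` as `x → 0⁺`; in particular
the periphery Lévy measure has infinite total mass. -/
theorem periphery_tail_asymptotics
    (σ τ a b : ℝ) (hσ : σ ∈ Set.Ioo (0:ℝ) 1) (hτ : 0 < τ) (ha : 0 < a) (hb : 0 < b) :
    Filter.Tendsto
      (fun x : ℝ => x ^ σ * ∫ t in Set.Ioi x, periphDensity σ τ a b t)
      (nhdsWithin 0 (Set.Ioi 0))
      (nhds (Real.Gamma (a + σ) / (σ * Real.Gamma a * b ^ σ * Real.Gamma (1 - σ)))) ∧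
    (∫⁻ t in Set.Ioi (0:ℝ), ENNReal.ofReal (periphDensity σ τ a b t) = ⊤) := by
  obtain ⟨hσ0, hσ1⟩ := hσ
  have hs : 0 < a + σ := by positivity
  have hΓ : 0 < Real.Gamma (1 - σ) := Real.Gamma_pos_of_pos (by linarith)
  have hΓa : 0 < Real.Gamma a := Real.Gamma_pos_of_pos ha
  have hΓs : 0 < Real.Gamma (a + σ) := Real.Gamma_pos_of_pos hs
  set K := b ^ a / Real.Gamma a * (Real.Gamma (1 - σ))⁻¹ with hK
  have hK0 : 0 < K := by positivity
  set H : ℝ → ℝ := fun x => K * dampedGammaIntegral (a + σ) b (1 + τ) x with hH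
  have hHc : Continuous H :=
    continuous_const.mul (continuous_dampedGammaIntegral hs hb (by linarith))
  have hHM : ∀ x, ‖H x‖ ≤ K * (Real.Gamma (a + σ) / b ^ (a + σ)) := fun x => by
    rw [norm_mul, Real.norm_of_nonneg hK0.le]
    exact mul_le_mul_of_nonneg_left (norm_dampedGammaIntegral_le hs hb (by linarith) x) hK0.le
  have heq : Set.EqOn (periphDensity σ τ a b) (fun t => t ^ (-1 - σ) * H t) (Set.Ioi 0) :=
    fun t ht => periphDensity_eq σ τ a b ht
  have hval : H 0 / σ
      = Real.Gamma (a + σ) / (σ * Real.Gamma a * b ^ σ * Real.Gamma (1 - σ)) := by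
    simp only [hH, dampedGammaIntegral_zero hs hb, hK, Real.rpow_add hb]
    field_simp
  have hlim : Filter.Tendsto (fun x : ℝ => x ^ σ * ∫ t in Set.Ioi x, periphDensity σ τ a b t)
      (nhdsWithin 0 (Set.Ioi 0))
      (nhds (Real.Gamma (a + σ) / (σ * Real.Gamma a * b ^ σ * Real.Gamma (1 - σ)))) := by
    rw [← hval]
    refine (tendsto_rpow_mul_integral_Ioi_rpow_mul hσ0 hHc hHM).congr'
      (eventually_nhdsWithin_of_forall fun x hx => ?_)
    have hx : (0:ℝ) < x := hx
    beta_reduce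
    rw [setIntegral_congr_fun measurableSet_Ioi (heq.mono (Set.Ioi_subset_Ioi hx.le))]
  refine ⟨hlim, lintegral_Ioi_eq_top_of_tendsto_rpow_mul_integral hσ0 (by positivity) ?_ ?_ hlim⟩
  · have hm : Measurable fun t => t ^ (-1 - σ) * H t := by
      have := hHc.measurable
      fun_prop
    exact hm.aestronglyMeasurable.congr
      ((ae_restrict_mem measurableSet_Ioi).mono fun t ht => (heq ht).symm)
  · intro t ht
    rw [heq ht]
    exact mul_nonneg (Real.rpow_nonneg (le_of_lt ht) _)
      (mul_nonneg hK0.le (dampedGammaIntegral_nonneg _ _ _ _))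
end

section
/- Let σ ∈ (0,1), τ > 0, a > 0, b > 0, ρ₀(w) = Γ(1−σ)⁻¹ w^(−1−σ) e^(−τw) and f_{a,b}(β) = (b^a/Γ(a)) β^(a−1) e^(−bβ). Then the core–periphery edge density constant I_cp = ∫₀^∞ ∫₀^∞ ∫₀^∞ ∫₀^∞ (1 − e^(−2ww′ββ′)) (1 − e^(−w)) e^(−w′) f_{a,b}(β) f_{a,b}(β′) ρ₀(w) ρ₀(w′) dβ dβ′ dw dw′ is finite and strictly positive. (This is the integral ∫∫ (1 − e^(−2w₁w₁′ − 2w₂w₂′)) ρ_c(dw₁,dw₂) ρ_p(dw₁′,dw₂′) from the proof of Theorem 1 for the specific model: a core node (w₁,w₂) = (w, wβ) interacts with a periphery node (0, w′β′) only through the sociabilities, giving connection probability 1 − e^(−2ww′ββ′); finiteness of I_cp is what makes N^(e)_{α,c−p} = Θ(α²) almost surely.) -/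
open MeasureTheory Real Set

theorem ggpDensity_pos {σ τ w : ℝ} (hσ : σ < 1) (hw : 0 < w) : 0 < ggpDensity σ τ w := by
  have := Real.Gamma_pos_of_pos (sub_pos.mpr hσ)
  unfold ggpDensity
  positivity

theorem gammaDensity_pos {a b β : ℝ} (ha : 0 < a) (hb : 0 < b) (hβ : 0 < β) :
    0 < gammaDensity a b β := by
  have := Real.Gamma_pos_of_pos ha
  unfold gammaDensity
  positivity

@[fun_prop]
theorem measurable_ggpDensity (σ τ : ℝ) : Measurable (ggpDensity σ τ) := by
  unfold ggpDensity
  fun_prop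

@[fun_prop]
theorem measurable_gammaDensity (a b : ℝ) : Measurable (gammaDensity a b) := by
  unfold gammaDensity
  fun_prop

/-- `x` times a multiple of `x ^ s * exp (-r * x)` has finite integral over the half-line. -/
theorem lintegral_mul_rpow_mul_exp_lt_top {c s r : ℝ} (hs : -2 < s) (hr : 0 < r) :
    ∫⁻ x in Ioi (0:ℝ), ENNReal.ofReal (x * (c * x ^ s * Real.exp (-r * x))) < ⊤ := by
  have h := (integrableOn_rpow_mul_exp_neg_mul_rpow (s := s + 1) (p := 1) (b := r)
    (by linarith) one_pos hr).const_mul c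
  refine lt_of_le_of_lt (le_of_eq ?_) h.lintegral_lt_top
  refine setLIntegral_congr_fun measurableSet_Ioi fun x hx => ?_
  simp only [Real.rpow_one, Real.rpow_add_one (ne_of_gt (mem_Ioi.mp hx))]
  congr 1
  ring

theorem lintegral_mul_ggpDensity_lt_top {σ τ : ℝ} (hσ : σ < 1) (hτ : 0 < τ) :
    ∫⁻ w in Ioi (0:ℝ), ENNReal.ofReal (w * ggpDensity σ τ w) < ⊤ :=
  lintegral_mul_rpow_mul_exp_lt_top (by linarith) hτ

theorem lintegral_mul_gammaDensity_lt_top {a b : ℝ} (ha : 0 < a) (hb : 0 < b) :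
    ∫⁻ β in Ioi (0:ℝ), ENNReal.ofReal (β * gammaDensity a b β) < ⊤ :=
  lintegral_mul_rpow_mul_exp_lt_top (by linarith) hb

theorem setLIntegral_Ioi_pos {f : ℝ → ENNReal} (hf : Measurable f) (h : ∀ x, 0 < x → 0 < f x) :
    0 < ∫⁻ x in Ioi (0:ℝ), f x := by
  rw [setLIntegral_pos_iff hf]
  have : Ioi (0:ℝ) ⊆ Function.support f ∩ Ioi 0 := fun x hx => ⟨(h x hx).ne', hx⟩
  exact lt_of_lt_of_le (by simp) (measure_mono this)

/-- An iterated integral of a positive measurable function over the half-line is positive. -/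
theorem iterated_setLIntegral_Ioi_pos {f : ((ℝ × ℝ) × ℝ) × ℝ → ENNReal} (hf : Measurable f)
    (h : ∀ x y z t, 0 < x → 0 < y → 0 < z → 0 < t → 0 < f (((x, y), z), t)) :
    0 < ∫⁻ x in Ioi (0:ℝ), ∫⁻ y in Ioi (0:ℝ), ∫⁻ z in Ioi (0:ℝ), ∫⁻ t in Ioi (0:ℝ),
      f (((x, y), z), t) := by
  have h₃ := hf.lintegral_prod_right' (ν := volume.restrict (Ioi (0:ℝ)))
  have h₂ := h₃.lintegral_prod_right' (ν := volume.restrict (Ioi (0:ℝ)))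
  have h₁ := h₂.lintegral_prod_right' (ν := volume.restrict (Ioi (0:ℝ)))
  refine setLIntegral_Ioi_pos h₁ fun x hx => ?_
  refine setLIntegral_Ioi_pos (h₂.comp measurable_prodMk_left) fun y hy => ?_
  refine setLIntegral_Ioi_pos (h₃.comp measurable_prodMk_left) fun z hz => ?_
  exact setLIntegral_Ioi_pos (hf.comp measurable_prodMk_left) fun t ht => h x y z t hx hy hz ht

/-- The integrand is dominated by a product of functions of one variable. -/
theorem core_periphery_integrand_le {σ τ a b w w' β β' : ℝ} (hσ : σ < 1) (ha : 0 < a)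
    (hb : 0 < b) (hw : 0 < w) (hw' : 0 < w') (hβ : 0 < β) (hβ' : 0 < β') :
    (1 - Real.exp (-(2 * w * w' * β * β'))) *
        (1 - Real.exp (-w)) * Real.exp (-w') *
        gammaDensity a b β * gammaDensity a b β' *
        ggpDensity σ τ w * ggpDensity σ τ w' ≤
      2 * ((w' * ggpDensity σ τ w') * ((w * ggpDensity σ τ w) *
        ((β' * gammaDensity a b β') * (β * gammaDensity a b β)))) := by
  have h₁ := ggpDensity_pos (τ := τ) hσ hw
  have h₂ := ggpDensity_pos (τ := τ) hσ hw'
  have h₃ := gammaDensity_pos ha hb hβ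
  have h₄ := gammaDensity_pos ha hb hβ'
  have e₁ : 1 - Real.exp (-(2 * w * w' * β * β')) ≤ 2 * w * w' * β * β' := by
    linarith [Real.add_one_le_exp (-(2 * w * w' * β * β'))]
  have e₂ : 1 - Real.exp (-w) ≤ 1 := by linarith [Real.exp_pos (-w)]
  have e₃ : 0 ≤ 1 - Real.exp (-w) := by
    linarith [Real.exp_le_one_iff.mpr (neg_nonpos.mpr hw.le)]
  have e₄ : Real.exp (-w') ≤ 1 := Real.exp_le_one_iff.mpr (neg_nonpos.mpr hw'.le)
  calc _ ≤ (2 * w * w' * β * β') * 1 * 1 *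
        gammaDensity a b β * gammaDensity a b β' * ggpDensity σ τ w * ggpDensity σ τ w' := by
        gcongr
    _ = _ := by ring

/-- The core–periphery edge density constant
`I_cp = ∫∫∫∫ (1 − e^(−2ww′ββ′)) (1 − e^(−w)) e^(−w′) f(β) f(β′) ρ₀(w) ρ₀(w′)`
is finite and strictly positive. -/
theorem core_periphery_constant_finite_positive
    (σ τ a b : ℝ) (hσ : σ ∈ Set.Ioo (0:ℝ) 1) (hτ : 0 < τ) (ha : 0 < a) (hb : 0 < b) :
    let Icp : ENNReal :=
      ∫⁻ w' in Set.Ioi (0:ℝ), ∫⁻ w in Set.Ioi (0:ℝ),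
        ∫⁻ β' in Set.Ioi (0:ℝ), ∫⁻ β in Set.Ioi (0:ℝ),
          ENNReal.ofReal
            ((1 - Real.exp (-(2 * w * w' * β * β'))) *
              (1 - Real.exp (-w)) * Real.exp (-w') *
              gammaDensity a b β * gammaDensity a b β' *
              ggpDensity σ τ w * ggpDensity σ τ w')
    0 < Icp ∧ Icp < ⊤ := by
  intro Icp
  constructor
  · refine iterated_setLIntegral_Ioi_pos (f := fun p => ENNReal.ofReal
      ((1 - Real.exp (-(2 * p.1.1.2 * p.1.1.1 * p.2 * p.1.2))) *
        (1 - Real.exp (-p.1.1.2)) * Real.exp (-p.1.1.1) *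
        gammaDensity a b p.2 * gammaDensity a b p.1.2 *
        ggpDensity σ τ p.1.1.2 * ggpDensity σ τ p.1.1.1)) (by fun_prop) ?_
    intro w' w β' β hw' hw hβ' hβ
    have h₁ := ggpDensity_pos (τ := τ) hσ.2 hw
    have h₂ := ggpDensity_pos (τ := τ) hσ.2 hw'
    have h₃ := gammaDensity_pos ha hb hβ
    have h₄ := gammaDensity_pos ha hb hβ'
    have e₁ : 0 < 1 - Real.exp (-(2 * w * w' * β * β')) :=
      sub_pos.mpr (Real.exp_lt_one_iff.mpr (neg_neg_of_pos (by positivity)))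
    have e₂ : 0 < 1 - Real.exp (-w) := sub_pos.mpr (Real.exp_lt_one_iff.mpr (neg_neg_of_pos hw))
    rw [ENNReal.ofReal_pos]
    positivity
  · have hG := lintegral_mul_gammaDensity_lt_top ha hb
    have hF := lintegral_mul_ggpDensity_lt_top hσ.2 hτ
    set F : ℝ → ENNReal := fun w => ENNReal.ofReal (w * ggpDensity σ τ w)
    set G : ℝ → ENNReal := fun β => ENNReal.ofReal (β * gammaDensity a b β)
    have hle : Icp ≤ ∫⁻ w' in Ioi (0:ℝ), ∫⁻ w in Ioi (0:ℝ), ∫⁻ β' in Ioi (0:ℝ),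
        ∫⁻ β in Ioi (0:ℝ), 2 * (F w' * (F w * (G β' * G β))) := by
      refine setLIntegral_mono' measurableSet_Ioi fun w' hw' => ?_
      refine setLIntegral_mono' measurableSet_Ioi fun w hw => ?_
      refine setLIntegral_mono' measurableSet_Ioi fun β' hβ' => ?_
      refine setLIntegral_mono' measurableSet_Ioi fun β hβ => ?_
      rw [mem_Ioi] at hw' hw hβ' hβ
      have h₁ := ggpDensity_pos (τ := τ) hσ.2 hw
      have h₂ := ggpDensity_pos (τ := τ) hσ.2 hw'
      have h₄ := gammaDensity_pos ha hb hβ'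
      refine (ENNReal.ofReal_le_ofReal
        (core_periphery_integrand_le hσ.2 ha hb hw hw' hβ hβ')).trans_eq ?_
      rw [ENNReal.ofReal_mul zero_le_two, ENNReal.ofReal_mul (mul_pos hw' h₂).le,
        ENNReal.ofReal_mul (mul_pos hw h₁).le, ENNReal.ofReal_mul (mul_pos hβ' h₄).le,
        ENNReal.ofReal_ofNat]
    have hFm : Measurable F := by fun_prop
    have hGm : Measurable G := by fun_prop
    refine hle.trans_lt ?_
    have hprod : ∫⁻ w' in Ioi (0:ℝ), ∫⁻ w in Ioi (0:ℝ), ∫⁻ β' in Ioi (0:ℝ),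
        ∫⁻ β in Ioi (0:ℝ), 2 * (F w' * (F w * (G β' * G β))) =
        2 * ((∫⁻ w in Ioi (0:ℝ), F w) * ((∫⁻ w in Ioi (0:ℝ), F w) *
          ((∫⁻ β in Ioi (0:ℝ), G β) * ∫⁻ β in Ioi (0:ℝ), G β))) := by
      simp (disch := fun_prop) only [lintegral_const_mul, lintegral_mul_const]
    rw [hprod]
    exact ENNReal.mul_lt_top (by simp) (ENNReal.mul_lt_top hF (ENNReal.mul_lt_top hF
      (ENNReal.mul_lt_top hG hG)))
end
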